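/- Let S be a semigroup and let R be an S-graded ring. Then R is nearly epsilon-strongly S-graded if and only if for all s ∈ S, t ∈ V(s) and r ∈ R_s, there exist elements ε_{s,t}(r) ∈ R_s R_t and ε'_{t,s}(r) ∈ R_t R_s such that ε_{s,t}(r) r = r = r ε'_{t,s}(r). -/

import Mathlib

open scoped Pointwise

/-- The set `E(S)` of idempotent elements of a semigroup `S`. -/
def idempotentSet (S : Type*) [Semigroup S] : Set S := {s | s * s = s}

/-- The set `V(s) = {t ∈ S ∣ sts = s and tst = t}`. -/
def invSet {S : Type*} [Semigroup S] (s : S) : Set S :=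
  {t | s * t * s = s ∧ t * s * t = t}

/-- The product `A B` of two additive subgroups of a ring: the additive subgroup
generated by all products `a * b` with `a ∈ A`, `b ∈ B`. -/
def subgroupMul {R : Type*} [NonUnitalRing R] (A B : AddSubgroup R) : AddSubgroup R :=
  AddSubgroup.closure ((A : Set R) * (B : Set R))

/-- `R` is an `S`-graded ring via the family `𝒜` of additive subgroups:
`R = ⊕_{s ∈ S} R_s` (internal direct sum) and `R_s R_t ⊆ R_{st}`. -/
structure IsSemigroupGrading {S R : Type*} [Semigroup S] [DecidableEq S] [NonUnitalRing R]
    (𝒜 : S → AddSubgroup R) : Prop where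
  internal : DirectSum.IsInternal 𝒜
  mul_mem : ∀ s t : S, ∀ a ∈ 𝒜 s, ∀ b ∈ 𝒜 t, a * b ∈ 𝒜 (s * t)

/-- `R` is symmetrically `S`-graded: `R_s = R_s R_t R_s` for all `s ∈ S`, `t ∈ V(s)`. -/
def SymmetricallyGraded {S R : Type*} [Semigroup S] [NonUnitalRing R]
    (𝒜 : S → AddSubgroup R) : Prop :=
  ∀ s : S, ∀ t ∈ invSet s, 𝒜 s = subgroupMul (subgroupMul (𝒜 s) (𝒜 t)) (𝒜 s)

/-- A subset `P` of `R` (closed under multiplication) is a unital ring: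
it has a two-sided multiplicative identity element. -/
def HasUnity {R : Type*} [NonUnitalRing R] (P : AddSubgroup R) : Prop :=
  ∃ u ∈ P, ∀ x ∈ P, u * x = x ∧ x * u = x

/-- A subset `P` of `R` is an s-unital ring: `x ∈ Px` and `x ∈ xP` for every `x ∈ P`. -/
def IsSUnital {R : Type*} [NonUnitalRing R] (P : AddSubgroup R) : Prop :=
  ∀ x ∈ P, (∃ u ∈ P, u * x = x) ∧ (∃ v ∈ P, x * v = x)

/-- A subset `P` of `R` is a von Neumann regular ring: `r ∈ rPr` for every `r ∈ P`. -/
def IsVonNeumannRegular {R : Type*} [NonUnitalRing R] (P : AddSubgroup R) : Prop :=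
  ∀ r ∈ P, ∃ x ∈ P, r = r * x * r

/-- `R` is epsilon-strongly `S`-graded. -/
def EpsilonStronglyGraded {S R : Type*} [Semigroup S] [NonUnitalRing R]
    (𝒜 : S → AddSubgroup R) : Prop :=
  SymmetricallyGraded 𝒜 ∧ ∀ s : S, ∀ t ∈ invSet s, HasUnity (subgroupMul (𝒜 s) (𝒜 t))

/-- `R` is nearly epsilon-strongly `S`-graded. -/
def NearlyEpsilonStronglyGraded {S R : Type*} [Semigroup S] [NonUnitalRing R]
    (𝒜 : S → AddSubgroup R) : Prop :=
  SymmetricallyGraded 𝒜 ∧ ∀ s : S, ∀ t ∈ invSet s, IsSUnital (subgroupMul (𝒜 s) (𝒜 t))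

/-- `R` is strongly `S`-graded: `R_s R_t = R_{st}` for all `s, t ∈ S`. -/
def StronglyGraded {S R : Type*} [Semigroup S] [NonUnitalRing R]
    (𝒜 : S → AddSubgroup R) : Prop :=
  ∀ s t : S, subgroupMul (𝒜 s) (𝒜 t) = 𝒜 (s * t)

/-- `R` is graded von Neumann regular: for all `s ∈ S`, `r ∈ R_s` and `t ∈ V(s)`,
there is `y ∈ R_t` with `r = ryr`. -/
def GradedVonNeumannRegular {S R : Type*} [Semigroup S] [NonUnitalRing R]
    (𝒜 : S → AddSubgroup R) : Prop :=
  ∀ s : S, ∀ r ∈ 𝒜 s, ∀ t ∈ invSet s, ∃ y ∈ 𝒜 t, r = r * y * r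

section SubgroupMul

variable {R : Type*} [NonUnitalRing R] {A B C P : AddSubgroup R}

theorem mul_mem_subgroupMul {a b : R} (ha : a ∈ A) (hb : b ∈ B) : a * b ∈ subgroupMul A B :=
  AddSubgroup.subset_closure (Set.mul_mem_mul ha hb)

theorem subgroupMul_le : subgroupMul A B ≤ C ↔ ∀ a ∈ A, ∀ b ∈ B, a * b ∈ C := by
  rw [subgroupMul, AddSubgroup.closure_le, Set.mul_subset_iff]
  rfl

theorem subgroupMul_assoc_le :
    subgroupMul (subgroupMul A B) C ≤ subgroupMul A (subgroupMul B C) := by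
  refine subgroupMul_le.2 fun x hx c hc => ?_
  suffices h : subgroupMul A B ≤
      (subgroupMul A (subgroupMul B C)).comap (AddMonoidHom.mulRight c) from h hx
  refine subgroupMul_le.2 fun a ha b hb => ?_
  change a * b * c ∈ subgroupMul A (subgroupMul B C)
  rw [mul_assoc]
  exact mul_mem_subgroupMul ha (mul_mem_subgroupMul hb hc)

/-- If `A` is stable under left multiplication by `p`, then so is `A B`. -/
theorem mul_mem_subgroupMul_of_left_stable {p : R} (h : ∀ a ∈ A, p * a ∈ A) {x : R}
    (hx : x ∈ subgroupMul A B) : p * x ∈ subgroupMul A B := by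
  suffices hle : subgroupMul A B ≤ (subgroupMul A B).comap (AddMonoidHom.mulLeft p) from hle hx
  refine subgroupMul_le.2 fun a ha b hb => ?_
  change p * (a * b) ∈ subgroupMul A B
  rw [← mul_assoc]
  exact mul_mem_subgroupMul (h a ha) hb

/-- Local left units for `A` are also available for `A B`. The proof builds, for each `e ∈ P`,
an element `f ∈ P` with `(1 - f) (1 - e) x = 0`. -/
theorem exists_left_unit_of_mem_subgroupMul (hP : ∀ p ∈ P, ∀ q ∈ P, p * q ∈ P)
    (hPA : ∀ p ∈ P, ∀ a ∈ A, p * a ∈ A) (hA : ∀ a ∈ A, ∃ e ∈ P, e * a = a) {x : R}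
    (hx : x ∈ subgroupMul A B) : ∃ e ∈ P, e * x = x := by
  suffices h : ∀ e ∈ P, ∃ f ∈ P, f * (x - e * x) = x - e * x by
    simpa using h 0 P.zero_mem
  induction hx using AddSubgroup.closure_induction with
  | mem x hx =>
    obtain ⟨a, ha, b, -, rfl⟩ := hx
    intro e he
    obtain ⟨f, hf, hfa⟩ := hA (a - e * a) (A.sub_mem ha (hPA e he a ha))
    refine ⟨f, hf, ?_⟩
    simpa only [sub_mul, mul_assoc] using congrArg (· * b) hfa
  | zero => exact fun e he => ⟨e, he, by simp⟩
  | add x y _ _ ihx ihy =>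
    intro e he
    obtain ⟨f, hf, hfx⟩ := ihx e he
    obtain ⟨g, hg, hgy⟩ := ihy (e + f - f * e)
      (P.sub_mem (P.add_mem he hf) (hP f hf e he))
    refine ⟨g + f - g * f, P.sub_mem (P.add_mem hg hf) (hP g hg f hf), ?_⟩
    have hgx := congrArg (g * ·) hfx
    rw [← sub_eq_zero] at hfx hgx hgy ⊢
    have hsum : (f * (x - e * x) - (x - e * x))
        - (g * (f * (x - e * x)) - g * (x - e * x))
        + (g * (y - (e + f - f * e) * y) - (y - (e + f - f * e) * y)) = 0 := by
      simp only [hfx, hgx, hgy, sub_self, add_zero]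
    rw [← hsum]
    noncomm_ring
  | neg x _ ih =>
    intro e he
    obtain ⟨f, hf, hfx⟩ := ih e he
    refine ⟨f, hf, ?_⟩
    rw [mul_neg, ← neg_sub', mul_neg, hfx]

/-- Local right units for `B` are also available for `A B`. -/
theorem exists_right_unit_of_mem_subgroupMul (hP : ∀ p ∈ P, ∀ q ∈ P, p * q ∈ P)
    (hBP : ∀ b ∈ B, ∀ p ∈ P, b * p ∈ B) (hB : ∀ b ∈ B, ∃ e ∈ P, b * e = b) {x : R}
    (hx : x ∈ subgroupMul A B) : ∃ e ∈ P, x * e = x := by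
  suffices h : ∀ e ∈ P, ∃ f ∈ P, (x - x * e) * f = x - x * e by
    simpa using h 0 P.zero_mem
  induction hx using AddSubgroup.closure_induction with
  | mem x hx =>
    obtain ⟨a, -, b, hb, rfl⟩ := hx
    intro e he
    obtain ⟨f, hf, hfb⟩ := hB (b - b * e) (B.sub_mem hb (hBP b hb e he))
    refine ⟨f, hf, ?_⟩
    rw [mul_assoc a, ← mul_sub, mul_assoc, hfb]
  | zero => exact fun e he => ⟨e, he, by simp⟩
  | add x y _ _ ihx ihy =>
    intro e he
    obtain ⟨f, hf, hfx⟩ := ihx e he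
    obtain ⟨g, hg, hgy⟩ := ihy (e + f - e * f)
      (P.sub_mem (P.add_mem he hf) (hP e he f hf))
    refine ⟨g + f - f * g, P.sub_mem (P.add_mem hg hf) (hP f hf g hg), ?_⟩
    have hgx := congrArg (· * g) hfx
    rw [← sub_eq_zero] at hfx hgx hgy ⊢
    have hsum : ((x - x * e) * f - (x - x * e))
        - ((x - x * e) * f * g - (x - x * e) * g)
        + ((y - y * (e + f - e * f)) * g - (y - y * (e + f - e * f))) = 0 := by
      simp only [hfx, hgx, hgy, sub_self, add_zero]
    rw [← hsum]
    noncomm_ring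
  | neg x _ ih =>
    intro e he
    obtain ⟨f, hf, hfx⟩ := ih e he
    refine ⟨f, hf, ?_⟩
    rw [neg_mul, ← neg_sub', neg_mul, hfx]

end SubgroupMul

theorem mem_invSet_symm {S : Type*} [Semigroup S] {s t : S} (h : t ∈ invSet s) : s ∈ invSet t :=
  ⟨h.2, h.1⟩

namespace IsSemigroupGrading

variable {S R : Type*} [Semigroup S] [DecidableEq S] [NonUnitalRing R] {𝒜 : S → AddSubgroup R}

theorem subgroupMul_le (hgr : IsSemigroupGrading 𝒜) (s t : S) :
    subgroupMul (𝒜 s) (𝒜 t) ≤ 𝒜 (s * t) :=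
  _root_.subgroupMul_le.2 (hgr.mul_mem s t)

theorem mul_mem_left (hgr : IsSemigroupGrading 𝒜) {s t : S} (ht : t ∈ invSet s) :
    ∀ p ∈ subgroupMul (𝒜 s) (𝒜 t), ∀ a ∈ 𝒜 s, p * a ∈ 𝒜 s := fun p hp a ha => by
  simpa only [ht.1] using hgr.mul_mem (s * t) s p (hgr.subgroupMul_le s t hp) a ha

theorem mul_mem_right (hgr : IsSemigroupGrading 𝒜) {s t : S} (ht : t ∈ invSet s) :
    ∀ b ∈ 𝒜 t, ∀ p ∈ subgroupMul (𝒜 s) (𝒜 t), b * p ∈ 𝒜 t := fun b hb p hp => by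
  simpa only [← mul_assoc, ht.2] using hgr.mul_mem t (s * t) b hb p (hgr.subgroupMul_le s t hp)

theorem mul_mem_subgroupMul (hgr : IsSemigroupGrading 𝒜) {s t : S} (ht : t ∈ invSet s) :
    ∀ p ∈ subgroupMul (𝒜 s) (𝒜 t), ∀ q ∈ subgroupMul (𝒜 s) (𝒜 t),
      p * q ∈ subgroupMul (𝒜 s) (𝒜 t) := fun p hp _ hq =>
  mul_mem_subgroupMul_of_left_stable (hgr.mul_mem_left ht p hp) hq

end IsSemigroupGrading

/-- **Proposition (nearly epsilon-strong gradings).**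
An `S`-graded ring `R` is nearly epsilon-strongly `S`-graded if and only if for all
`s ∈ S`, `t ∈ V(s)` and `r ∈ R_s` there exist `ε_{s,t}(r) ∈ R_s R_t` and
`ε'_{t,s}(r) ∈ R_t R_s` such that `ε_{s,t}(r) r = r = r ε'_{t,s}(r)`. -/
theorem nearlyEpsilonStronglyGraded_iff
    {S R : Type*} [Semigroup S] [DecidableEq S] [NonUnitalRing R]
    (𝒜 : S → AddSubgroup R) (hgr : IsSemigroupGrading 𝒜) :
    NearlyEpsilonStronglyGraded 𝒜 ↔
      ∀ s : S, ∀ t ∈ invSet s, ∀ r ∈ 𝒜 s,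
        (∃ ε ∈ subgroupMul (𝒜 s) (𝒜 t), ε * r = r) ∧
        (∃ ε' ∈ subgroupMul (𝒜 t) (𝒜 s), r * ε' = r) := by
  constructor
  · rintro ⟨hsymm, hunit⟩ s t ht r hr
    have hr' := hr
    rw [hsymm s t ht] at hr'
    have hst := hgr.mul_mem_subgroupMul ht
    have hts := hgr.mul_mem_subgroupMul (mem_invSet_symm ht)
    exact ⟨exists_left_unit_of_mem_subgroupMul hst hst (fun p hp => (hunit s t ht p hp).1) hr',
      exists_right_unit_of_mem_subgroupMul hts hts
        (fun p hp => (hunit t s (mem_invSet_symm ht) p hp).2) (subgroupMul_assoc_le hr')⟩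
  · refine fun h => ⟨fun s t ht => le_antisymm (fun r hr => ?_) ?_, fun s t ht x hx => ⟨?_, ?_⟩⟩
    · obtain ⟨⟨ε, hε, hεr⟩, -⟩ := h s t ht r hr
      rw [← hεr]
      exact mul_mem_subgroupMul hε hr
    · exact subgroupMul_le.2 (hgr.mul_mem_left ht)
    · exact exists_left_unit_of_mem_subgroupMul (hgr.mul_mem_subgroupMul ht)
        (hgr.mul_mem_left ht) (fun a ha => (h s t ht a ha).1) hx
    · exact exists_right_unit_of_mem_subgroupMul (hgr.mul_mem_subgroupMul ht)
        (hgr.mul_mem_right ht) (fun b hb => (h t s (mem_invSet_symm ht) b hb).2) hx
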